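/- arXiv:math/0012203 — 3 statements merged into one kernel-verified Lean document; each statement's English description precedes it below -/
import Mathlib

section
/- For every irrational θ ∈ (0,1), liminf_{t→0⁺} t · ∑_{(m,n)∈ℤ×ℤ} sin²(πθn) e^{−t(m²+n²)/2} ≥ 2√π/e. -/
open Filter Topology

open HurwitzZeta in
/-- The cosine kernel as a sum of real terms. -/
theorem hasSum_cos_mul_exp_cosKernel (a : ℝ) {x : ℝ} (hx : 0 < x) :
    HasSum (fun n : ℤ => Real.cos (2 * Real.pi * a * n) * Real.exp (-Real.pi * n ^ 2 * x))
      (cosKernel a x) := by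
  have h := Complex.hasSum_re (hasSum_int_cosKernel a hx)
  rw [Complex.ofReal_re] at h
  refine h.congr_fun fun n => ?_
  rw [Complex.re_mul_ofReal, ← Complex.exp_ofReal_mul_I_re]
  push_cast
  ring_nf

open HurwitzZeta in
/-- Behaviour of the cosine kernel near `0`, from its functional equation. -/
theorem tendsto_sqrt_mul_cosKernel (a : UnitAddCircle) [Decidable (a = 0)] :
    Tendsto (fun x : ℝ => √x * cosKernel a x) (𝓝[>] 0) (𝓝 (if a = 0 then 1 else 0)) := by
  obtain ⟨p, hp, h⟩ := isBigO_atTop_evenKernel_sub a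
  have hexp : Tendsto (fun x : ℝ => Real.exp (-p * x)) atTop (𝓝 0) :=
    Real.tendsto_exp_atBot.comp (tendsto_id.const_mul_atTop_of_neg (neg_neg_of_pos hp))
  have htop : Tendsto (evenKernel a) atTop (𝓝 (if a = 0 then 1 else 0)) := by
    rw [← tendsto_sub_nhds_zero_iff]
    convert h.trans_tendsto hexp
  refine (htop.comp tendsto_inv_nhdsGT_zero).congr' ?_
  filter_upwards [self_mem_nhdsWithin] with x hx
  have hx : 0 < x := hx
  rw [Function.comp_apply, evenKernel_functional_equation, ← Real.sqrt_eq_rpow, Real.sqrt_inv]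
  simp

open HurwitzZeta in
/-- Closed form of the heat-weighted double sum in terms of cosine kernels. -/
theorem tsum_sin_sq_mul_exp_eq_cosKernel (θ : ℝ) {x : ℝ} (hx : 0 < x) :
    ∑' p : ℤ × ℤ, Real.sin (Real.pi * θ * (p.2 : ℝ)) ^ 2 *
        Real.exp (-(2 * Real.pi * x) * ((p.1 : ℝ) ^ 2 + (p.2 : ℝ) ^ 2) / 2) =
      cosKernel 0 x * ((cosKernel 0 x - cosKernel θ x) / 2) := by
  have h0 : HasSum (fun n : ℤ => Real.exp (-Real.pi * n ^ 2 * x)) (cosKernel 0 x) := by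
    simpa using hasSum_cos_mul_exp_cosKernel 0 hx
  have h1 : HasSum
      (fun n : ℤ => Real.sin (Real.pi * θ * n) ^ 2 * Real.exp (-Real.pi * n ^ 2 * x))
      ((cosKernel 0 x - cosKernel θ x) / 2) := by
    refine ((h0.sub (hasSum_cos_mul_exp_cosKernel θ hx)).div_const 2).congr_fun fun n => ?_
    rw [Real.sin_sq_eq_half_sub]
    ring_nf
  have hs := h0.summable.mul_of_nonneg h1.summable
    (fun n => (Real.exp_pos _).le) (fun n => by positivity)
  refine ((h0.mul h1 hs).congr_fun fun p => ?_).tsum_eq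
  rw [show -(2 * Real.pi * x) * ((p.1 : ℝ) ^ 2 + (p.2 : ℝ) ^ 2) / 2 =
    -Real.pi * p.1 ^ 2 * x + -Real.pi * p.2 ^ 2 * x by ring, Real.exp_add]
  ring

theorem Irrational.coe_unitAddCircle_ne_zero {θ : ℝ} (hθ : Irrational θ) :
    (θ : UnitAddCircle) ≠ 0 := by
  rw [Ne, AddCircle.coe_eq_zero_iff]
  rintro ⟨n, hn⟩
  exact hθ.ne_int n (by simpa using hn.symm)

/-- The rescaled double sum converges to `π`. -/
theorem tendsto_mul_tsum_sin_sq_mul_exp {θ : ℝ} (hθ : Irrational θ) :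
    Tendsto (fun t : ℝ => t *
        ∑' p : ℤ × ℤ, Real.sin (Real.pi * θ * (p.2 : ℝ)) ^ 2 *
          Real.exp (-t * ((p.1 : ℝ) ^ 2 + (p.2 : ℝ) ^ 2) / 2))
      (𝓝[>] 0) (𝓝 Real.pi) := by
  classical
  have h0 := tendsto_sqrt_mul_cosKernel 0
  have hθ' := tendsto_sqrt_mul_cosKernel (θ : UnitAddCircle)
  rw [if_pos rfl] at h0
  rw [if_neg hθ.coe_unitAddCircle_ne_zero] at hθ'
  have hlim := ((h0.mul (h0.sub hθ')).const_mul Real.pi)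
  rw [sub_zero, mul_one, mul_one] at hlim
  have hscale : Tendsto (fun t : ℝ => t / (2 * Real.pi)) (𝓝[>] 0) (𝓝[>] 0) := by
    refine tendsto_nhdsWithin_iff.2 ⟨?_, ?_⟩
    · exact ((continuous_id.div_const (2 * Real.pi)).tendsto' 0 0 (by simp)).mono_left
        nhdsWithin_le_nhds
    · filter_upwards [self_mem_nhdsWithin] with t ht
      exact div_pos ht Real.two_pi_pos
  refine (hlim.comp hscale).congr' ?_
  filter_upwards [self_mem_nhdsWithin] with t ht
  obtain ⟨x, hx, rfl⟩ : ∃ x : ℝ, 0 < x ∧ t = 2 * Real.pi * x :=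
    ⟨t / (2 * Real.pi), div_pos ht Real.two_pi_pos, by field_simp⟩
  rw [tsum_sin_sq_mul_exp_eq_cosKernel θ hx, Function.comp_apply,
    mul_div_cancel_left₀ x Real.two_pi_pos.ne']
  linear_combination (Real.pi * HurwitzZeta.cosKernel 0 x *
    (HurwitzZeta.cosKernel 0 x - HurwitzZeta.cosKernel θ x)) * Real.mul_self_sqrt hx.le

theorem two_mul_sqrt_pi_div_exp_one_le_pi : 2 * √Real.pi / Real.exp 1 ≤ Real.pi := by
  have he : 2 ≤ Real.exp 1 := by linarith [Real.add_one_le_exp (1 : ℝ)]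
  have hsqrt : √Real.pi ≤ Real.pi :=
    Real.sqrt_le_self_iff.2 (.inr <| by linarith [Real.pi_gt_three])
  rw [div_le_iff₀ (Real.exp_pos 1)]
  nlinarith [Real.pi_pos]

/-- For every irrational `θ ∈ (0,1)`,
`liminf_{t→0⁺} t · ∑_{(m,n)∈ℤ×ℤ} sin²(πθn) e^{−t(m²+n²)/2} ≥ 2√π/e`
(the strict positivity underlying the change of integrated scalar curvature in
Theorem 3.2(ii)). -/
theorem liminf_double_sum_curvature_lower_bound
    (θ : ℝ) (hθmem : θ ∈ Set.Ioo (0 : ℝ) 1) (hθ : Irrational θ) :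
    2 * Real.sqrt Real.pi / Real.exp 1 ≤
      Filter.liminf
        (fun t : ℝ => t *
          ∑' p : ℤ × ℤ, Real.sin (Real.pi * θ * (p.2 : ℝ)) ^ 2 *
            Real.exp (-t * ((p.1 : ℝ) ^ 2 + (p.2 : ℝ) ^ 2) / 2))
        (𝓝[>] 0) := by
  rw [(tendsto_mul_tsum_sin_sq_mul_exp hθ).liminf_eq]
  exact two_mul_sqrt_pi_div_exp_one_le_pi
end

section
/- Let A be an associative unital ℂ-algebra, E a right A-module, d₁, d₂ : A → A ℂ-linear derivations, and ∇₁, ∇₂ : E → E ℂ-linear maps satisfying the Leibniz rule ∇ᵢ(ξa) = ∇ᵢ(ξ)a + ξ dᵢ(a) for all ξ ∈ E, a ∈ A. Fix r₁, r₂ ∈ A and define the perturbed maps ∇ᵢ′(ξ) = ∇ᵢ(ξ) − ξrᵢ. Then for all ξ ∈ E: −ξ·(d₁(r₂) − d₂(r₁) + r₁r₂ − r₂r₁) − (∇₁′(∇₂′(ξ)) − ∇₂′(∇₁′(ξ))) = −(∇₁(∇₂(ξ)) − ∇₂(∇₁(ξ))). -/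
open MulOpposite

/-- Let `A` be an associative unital ℂ-algebra, `E` a right `A`-module
(formalized as a module over `Aᵐᵒᵖ`, with `ξ·a = op a • ξ`), `d₁, d₂ : A → A` ℂ-linear
derivations, and `∇₁, ∇₂ : E → E` ℂ-linear maps satisfying the Leibniz rule
`∇ᵢ(ξa) = ∇ᵢ(ξ)a + ξ dᵢ(a)`. Fix `r₁, r₂ ∈ A` and let `∇ᵢ′(ξ) = ∇ᵢ(ξ) − ξrᵢ`. Then
`−ξ·(d₁(r₂) − d₂(r₁) + r₁r₂ − r₂r₁) − (∇₁′∇₂′ − ∇₂′∇₁′)(ξ) = −(∇₁∇₂ − ∇₂∇₁)(ξ)`: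
the curvature two-form is invariant under perturbation by inner derivations. -/
theorem curvature_invariant_under_inner_perturbation
    {A : Type*} [Ring A] [Algebra ℂ A]
    {E : Type*} [AddCommGroup E] [Module ℂ E] [Module Aᵐᵒᵖ E]
    (d₁ d₂ : A →ₗ[ℂ] A)
    (hd₁ : ∀ a b : A, d₁ (a * b) = d₁ a * b + a * d₁ b)
    (hd₂ : ∀ a b : A, d₂ (a * b) = d₂ a * b + a * d₂ b)
    (N₁ N₂ : E →ₗ[ℂ] E)
    (hN₁ : ∀ (ξ : E) (a : A), N₁ (op a • ξ) = op a • N₁ ξ + op (d₁ a) • ξ)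
    (hN₂ : ∀ (ξ : E) (a : A), N₂ (op a • ξ) = op a • N₂ ξ + op (d₂ a) • ξ)
    (r₁ r₂ : A)
    (N₁' N₂' : E → E)
    (hN₁' : ∀ ξ : E, N₁' ξ = N₁ ξ - op r₁ • ξ)
    (hN₂' : ∀ ξ : E, N₂' ξ = N₂ ξ - op r₂ • ξ) :
    ∀ ξ : E,
      -(op (d₁ r₂ - d₂ r₁ + (r₁ * r₂ - r₂ * r₁)) • ξ) - (N₁' (N₂' ξ) - N₂' (N₁' ξ)) =
        -(N₁ (N₂ ξ) - N₂ (N₁ ξ)) := by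
  intro ξ
  simp only [hN₁', hN₂', map_sub, hN₁, hN₂, smul_sub, op_add, op_sub, op_mul, add_smul, sub_smul, mul_smul]
  abel
end

section
/- Let d ≥ 1, f ∈ C_c^∞(ℝ^{2d}) and t > 0, and let 𝓣_t be the heat semigroup on L²(ℝ^{2d}) given by (𝓣_tφ)(x) = (2πt)^{−d} ∫_{ℝ^{2d}} e^{−‖x−y‖²/(2t)} φ(y) dy. Then for every Hilbert (orthonormal) basis (e_i)_{i∈I} of L²(ℝ^{2d}), the family (⟨e_i, M_f 𝓣_t e_i⟩)_{i∈I} is summable with ∑_{i∈I} ⟨e_i, M_f 𝓣_t e_i⟩ = (2πt)^{−d} ∫_{ℝ^{2d}} f(x) dx. In particular t^{d}·(2π)^{d}·∑_{i∈I} ⟨e_i, M_f 𝓣_t e_i⟩ = ∫ f(x) dx for every t > 0. -/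
open MeasureTheory
noncomputable section

/-- The heat semigroup `𝓣_t` on `ℝ^{2d}`:
`(𝓣_tφ)(x) = (2πt)^{−d} ∫ e^{−‖x−y‖²/(2t)} φ(y) dy`. -/
def heatSemigroup (d : ℕ) (t : ℝ) (φ : EuclideanSpace ℝ (Fin (2 * d)) → ℂ)
    (x : EuclideanSpace ℝ (Fin (2 * d))) : ℂ :=
  (((2 * Real.pi * t) ^ d : ℝ) : ℂ)⁻¹ *
    ∫ y : EuclideanSpace ℝ (Fin (2 * d)),
      ((Real.exp (-‖x - y‖ ^ 2 / (2 * t)) : ℝ) : ℂ) * φ y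

section Gaussian

variable {V : Type*} [NormedAddCommGroup V]

/-- The complex-valued Gaussian `x ↦ e^{-a‖x‖²}`. -/
def gauss (a : ℝ) (x : V) : ℂ := ((Real.exp (-a * ‖x‖ ^ 2) : ℝ) : ℂ)

lemma norm_gauss (a : ℝ) (x : V) : ‖gauss a x‖ = Real.exp (-a * ‖x‖ ^ 2) := by
  rw [gauss, Complex.norm_real, Real.norm_of_nonneg (Real.exp_nonneg _)]

lemma continuous_gauss (a : ℝ) : Continuous (gauss a : V → ℂ) := by
  unfold gauss; fun_prop

lemma gauss_sub_comm (a : ℝ) (x y : V) : gauss a (x - y) = gauss a (y - x) := by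
  simp [gauss, norm_sub_rev]

lemma conj_gauss (a : ℝ) (x : V) : (starRingEnd ℂ) (gauss a x) = gauss a x := by
  rw [gauss, Complex.conj_ofReal]

lemma gauss_mul_self (a : ℝ) (x : V) : gauss a x * gauss a x = gauss (2 * a) x := by
  simp only [gauss]
  rw [← Complex.ofReal_mul, ← Real.exp_add]
  ring_nf

lemma norm_gauss_sq (a : ℝ) (x : V) : ‖gauss a x‖ ^ 2 = ‖gauss (2 * a) x‖ := by
  rw [← gauss_mul_self, norm_mul, sq]

lemma norm_gauss_mul_le (a : ℝ) (x : V) (w : ℂ) :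
    ‖gauss a x * w‖ ≤ (‖gauss (2 * a) x‖ + ‖w‖ ^ 2) / 2 := by
  rw [norm_mul, ← norm_gauss_sq]
  nlinarith [sq_nonneg (‖gauss a x‖ - ‖w‖)]

variable [InnerProductSpace ℝ V]

/-- Completing the square around the midpoint of `x` and `y`. -/
lemma gauss_mul_gauss (a : ℝ) (x y z : V) :
    gauss a (x - z) * gauss a (z - y) =
      gauss (2 * a) (z - (1 / 2 : ℝ) • (x + y)) * gauss (a / 2) (x - y) := by
  simp only [gauss]
  rw [← Complex.ofReal_mul, ← Complex.ofReal_mul, ← Real.exp_add, ← Real.exp_add]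
  congr 2
  have h := parallelogram_law_with_norm ℝ (x - z) (z - y)
  have e1 : x - z + (z - y) = x - y := by abel
  have e2 : x - z - (z - y) = (-2 : ℝ) • (z - (1 / 2 : ℝ) • (x + y)) := by module
  rw [e1, e2, norm_smul, Real.norm_eq_abs, abs_of_neg (by norm_num : (-2 : ℝ) < 0)] at h
  linear_combination (a / 2) * h

variable [FiniteDimensional ℝ V] [MeasurableSpace V] [BorelSpace V]

lemma integrable_gauss {a : ℝ} (ha : 0 < a) : Integrable (gauss a : V → ℂ) := by
  have := GaussianFourier.integrable_cexp_neg_mul_sq_norm_add (V := V) (b := (a : ℂ))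
    (by simpa using ha) 0 0
  refine this.congr (.of_forall fun x => ?_)
  simp [gauss]

lemma integral_gauss_ne_zero {a : ℝ} (ha : 0 < a) : ∫ x : V, gauss a x ≠ 0 := by
  simp only [gauss]
  rw [integral_complex_ofReal, GaussianFourier.integral_rexp_neg_mul_sq_norm ha]
  exact_mod_cast (by positivity)

lemma integral_gauss_mul_gauss (a : ℝ) (x y : V) :
    ∫ z, gauss a (x - z) * gauss a (z - y) =
      (∫ z : V, gauss (2 * a) z) * gauss (a / 2) (x - y) := by
  simp_rw [gauss_mul_gauss]
  rw [integral_mul_const, integral_sub_right_eq_self (gauss (2 * a))]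

lemma memLp_gauss_sub {a : ℝ} (ha : 0 < a) (z : V) :
    MemLp (fun x => gauss a (x - z)) 2 volume := by
  have hc : Continuous fun x : V => gauss a (x - z) :=
    (continuous_gauss a).comp (continuous_id.sub continuous_const)
  rw [memLp_two_iff_integrable_sq_norm hc.aestronglyMeasurable]
  simp_rw [norm_gauss_sq]
  exact ((integrable_gauss (by positivity : 0 < 2 * a)).comp_sub_right z).norm

lemma memLp_mul_gauss_sub {f : V → ℂ} (hf : Continuous f) (hs : HasCompactSupport f)
    (a : ℝ) (z : V) : MemLp (fun x => f x * gauss a (x - z)) 2 volume :=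
  (hf.mul ((continuous_gauss a).comp (continuous_id.sub continuous_const))).memLp_of_hasCompactSupport
    hs.mul_right

lemma integrable_gauss_mul {a : ℝ} (ha : 0 < a) {e : V → ℂ} (he : MemLp e 2 volume) (z : V) :
    Integrable fun y => gauss a (z - y) * e y := by
  simp_rw [gauss_sub_comm a z]
  exact (memLp_gauss_sub ha z).integrable_mul he

lemma norm_integral_gauss_mul_le {a : ℝ} (ha : 0 < a) {e : V → ℂ} (he : MemLp e 2 volume)
    (z : V) :
    ‖∫ y, gauss a (z - y) * e y‖ ≤
      ((∫ y : V, ‖gauss (2 * a) y‖) + ∫ y, ‖e y‖ ^ 2) / 2 := by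
  have h1 : Integrable fun y : V => ‖gauss (2 * a) (z - y)‖ :=
    ((integrable_gauss (by positivity : 0 < 2 * a)).comp_sub_left z).norm
  have h2 : Integrable fun y : V => ‖e y‖ ^ 2 :=
    (memLp_two_iff_integrable_sq_norm he.aestronglyMeasurable).1 he
  calc ‖∫ y, gauss a (z - y) * e y‖
      ≤ ∫ y, (‖gauss (2 * a) (z - y)‖ + ‖e y‖ ^ 2) / 2 :=
        norm_integral_le_of_norm_le ((h1.add h2).div_const 2)
          (.of_forall fun y => norm_gauss_mul_le a _ _)
    _ = _ := by
        rw [integral_div, integral_add h1 h2,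
          integral_sub_left_eq_self (fun y : V => ‖gauss (2 * a) y‖)]

lemma aestronglyMeasurable_integral_gauss_mul (a : ℝ) {e : V → ℂ}
    (he : AEStronglyMeasurable e volume) :
    AEStronglyMeasurable (fun z => ∫ y, gauss a (z - y) * e y) volume := by
  have h : AEStronglyMeasurable (fun p : V × V => gauss a (p.1 - p.2) * e p.2)
      (volume.prod volume) :=
    (((continuous_gauss a).comp (continuous_fst.sub continuous_snd)).aestronglyMeasurable).mul
      he.comp_snd
  exact h.integral_prod_right'

/-- The semigroup property of the heat kernel, applied to a square integrable function. -/
lemma integral_gauss_mul_integral {a : ℝ} (ha : 0 < a) {e : V → ℂ} (he : MemLp e 2 volume)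
    (x : V) :
    ∫ z, gauss a (x - z) * ∫ y, gauss a (z - y) * e y =
      (∫ z : V, gauss (2 * a) z) * ∫ y, gauss (a / 2) (x - y) * e y := by
  have h2a : 0 < 2 * a := by positivity
  have hx : Integrable fun z : V => gauss a (x - z) := (integrable_gauss ha).comp_sub_left x
  have h1 : Integrable (fun p : V × V => ‖gauss a (x - p.1)‖ * ‖gauss (2 * a) (p.1 - p.2)‖)
      (volume.prod volume) := by
    have := (Integrable.convolution_integrand (ContinuousLinearMap.mul ℝ ℂ)
      (μ := (volume : Measure V)) hx (integrable_gauss h2a)).swap.norm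
    refine this.congr (.of_forall fun p => ?_)
    simp [gauss_sub_comm (2 * a) p.1 p.2]
  have h2 : Integrable (fun p : V × V => ‖gauss a (x - p.1)‖ * ‖e p.2‖ ^ 2)
      (volume.prod volume) :=
    hx.norm.mul_prod ((memLp_two_iff_integrable_sq_norm he.aestronglyMeasurable).1 he)
  have hm : AEStronglyMeasurable
      (fun p : V × V => gauss a (x - p.1) * (gauss a (p.1 - p.2) * e p.2))
      (volume.prod volume) :=
    (((continuous_gauss a).comp (continuous_const.sub continuous_fst)).aestronglyMeasurable).mul
      ((((continuous_gauss a).comp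
        (continuous_fst.sub continuous_snd)).aestronglyMeasurable).mul
        he.aestronglyMeasurable.comp_snd)
  have hint : Integrable
      (fun p : V × V => gauss a (x - p.1) * (gauss a (p.1 - p.2) * e p.2))
      (volume.prod volume) := by
    refine ((h1.add h2).div_const 2).mono' hm (.of_forall fun p => ?_)
    rw [norm_mul]
    refine (mul_le_mul_of_nonneg_left (norm_gauss_mul_le a (p.1 - p.2) (e p.2))
      (norm_nonneg _)).trans (le_of_eq ?_)
    simp only [Pi.add_apply]
    ring
  simp_rw [← integral_const_mul]
  rw [integral_integral_swap hint]
  congr 1 with y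
  simp_rw [← mul_assoc]
  rw [integral_mul_const, integral_gauss_mul_gauss]

lemma integral_mul_integral_gauss_mul {a : ℝ} (ha : 0 < a) {h B : V → ℂ} (hh : Integrable h)
    (hB : AEStronglyMeasurable B volume) {C : ℝ} (hC : ∀ z, ‖B z‖ ≤ C) :
    Integrable (fun z => B z * ∫ x, h x * gauss a (x - z)) ∧
    ∫ x, h x * ∫ z, gauss a (x - z) * B z = ∫ z, B z * ∫ x, h x * gauss a (x - z) := by
  have h1 : Integrable (fun p : V × V => h p.1 * gauss a (p.1 - p.2)) (volume.prod volume) := by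
    have := (Integrable.convolution_integrand (ContinuousLinearMap.mul ℝ ℂ)
      (μ := (volume : Measure V)) hh (integrable_gauss ha)).swap
    refine this.congr (.of_forall fun p => ?_)
    simp [gauss_sub_comm a p.1 p.2]
  have h2 : Integrable (fun p : V × V => B p.2 * (h p.1 * gauss a (p.1 - p.2)))
      (volume.prod volume) :=
    h1.bdd_mul hB.comp_snd (.of_forall fun p => hC p.2)
  simp_rw [← integral_const_mul]
  refine ⟨h2.integral_prod_right, ?_⟩
  refine Eq.trans ?_ (integral_integral_swap h2)
  congr 1 with x
  congr 1 with z
  ring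

/-- Multiplication by a compactly supported function localizes translates of the Gaussian. -/
lemma exists_norm_toLp_mul_gauss_sub_sq_le {f : V → ℂ} (hf : Continuous f)
    (hs : HasCompactSupport f) {a : ℝ} (ha : 0 < a) :
    ∃ C : ℝ, ∀ z : V, ∫ x, ‖f x * gauss a (x - z)‖ ^ 2 ≤ C * ‖gauss (a / 2) z‖ ^ 2 := by
  obtain ⟨R, hR⟩ := hs.isCompact.isBounded.exists_norm_le
  have hf2 : Integrable fun x => ‖f x‖ ^ 2 :=
    (memLp_two_iff_integrable_sq_norm hf.aestronglyMeasurable).1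
      (hf.memLp_of_hasCompactSupport hs)
  refine ⟨(∫ x, ‖f x‖ ^ 2) * Real.exp (2 * a * R ^ 2), fun z => ?_⟩
  rw [mul_assoc, ← integral_mul_const]
  refine integral_mono_of_nonneg (.of_forall fun x => by positivity) (hf2.mul_const _)
    (.of_forall fun x => ?_)
  by_cases hx : f x = 0
  · simp [hx]
  have hxR : ‖x‖ ≤ R := hR x (subset_tsupport f hx)
  simp only [norm_mul, mul_pow]
  refine mul_le_mul_of_nonneg_left ?_ (by positivity)
  rw [norm_gauss_sq, norm_gauss_sq, norm_gauss, norm_gauss, ← Real.exp_add]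
  refine Real.exp_le_exp.2 ?_
  have h1 : ‖z‖ ≤ ‖x - z‖ + ‖x‖ := by
    have := norm_sub_le x (x - z)
    rw [sub_sub_cancel] at this
    linarith
  have h2 : ‖z‖ ^ 2 ≤ 2 * ‖x - z‖ ^ 2 + 2 * R ^ 2 := by
    have h3 : ‖z‖ ≤ ‖x - z‖ + R := by linarith
    nlinarith [norm_nonneg z, sq_nonneg (‖x - z‖ - R)]
  nlinarith

end Gaussian

section Trace

variable {V : Type*} [NormedAddCommGroup V] [InnerProductSpace ℝ V]
  [FiniteDimensional ℝ V] [MeasurableSpace V] [BorelSpace V]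

lemma Orthonormal.countable_index {𝕜 E ι : Type*} [RCLike 𝕜] [NormedAddCommGroup E]
    [InnerProductSpace 𝕜 E] [TopologicalSpace.SeparableSpace E] {v : ι → E}
    (hv : Orthonormal 𝕜 v) : Countable ι := by
  refine Pairwise.countable_of_isOpen_disjoint (s := fun i => Metric.ball (v i) (1 / 2))
    (fun i j hij => ?_) (fun _ => Metric.isOpen_ball) (fun i => ⟨v i, by simp⟩)
  refine Metric.ball_disjoint_ball ?_
  have h : ‖v i - v j‖ ^ 2 = 2 := by
    rw [@norm_sub_sq 𝕜, hv.1 i, hv.1 j, hv.2 hij]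
    norm_num
  rw [dist_eq_norm]
  nlinarith [norm_nonneg (v i - v j)]

lemma norm_toLp_sq {g : V → ℂ} (hg : MemLp g 2 volume) :
    ‖hg.toLp g‖ ^ 2 = ∫ x, ‖g x‖ ^ 2 := by
  have h : ((‖hg.toLp g‖ ^ 2 : ℝ) : ℂ) = ((∫ x, ‖g x‖ ^ 2 : ℝ) : ℂ) := by
    have := inner_self_eq_norm_sq_to_K (𝕜 := ℂ) (hg.toLp g)
    push_cast
    rw [← integral_complex_ofReal]
    refine this.symm.trans ?_
    rw [L2.inner_def]
    refine integral_congr_ae (hg.coeFn_toLp.mono fun x hx => ?_)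
    simp only [hx]
    rw [inner_self_eq_norm_sq_to_K]
    simp
  exact_mod_cast h

lemma inner_toLp_left {g : V → ℂ} (hg : MemLp g 2 volume) (e : Lp ℂ 2 (volume : Measure V)) :
    inner ℂ (hg.toLp g) e = ∫ x, (starRingEnd ℂ) (g x) * e x := by
  rw [L2.inner_def]
  refine integral_congr_ae (hg.coeFn_toLp.mono fun x hx => ?_)
  simp only [hx, RCLike.inner_apply, mul_comm]

lemma inner_toLp_right {g : V → ℂ} (hg : MemLp g 2 volume) (e : Lp ℂ 2 (volume : Measure V)) :
    inner ℂ e (hg.toLp g) = ∫ x, (starRingEnd ℂ) (e x) * g x := by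
  rw [L2.inner_def]
  refine integral_congr_ae (hg.coeFn_toLp.mono fun x hx => ?_)
  simp only [hx, RCLike.inner_apply, mul_comm]

lemma inner_toLp_toLp {g h : V → ℂ} (hg : MemLp g 2 volume) (hh : MemLp h 2 volume) :
    inner ℂ (hg.toLp g) (hh.toLp h) = ∫ x, (starRingEnd ℂ) (g x) * h x := by
  rw [inner_toLp_left]
  exact integral_congr_ae (hh.coeFn_toLp.mono fun x hx => by simp only [hx])

/-- If `∑ i, ⟪u z, b i⟫ ⟪b i, v z⟫` is dominated through a weight `w`, it may be integrated
term by term. -/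
lemma HilbertBasis.hasSum_integral_inner_mul_inner {α E ι : Type*} [MeasurableSpace α]
    {μ : Measure α} [NormedAddCommGroup E] [InnerProductSpace ℂ E] [Countable ι]
    (b : HilbertBasis ι ℂ E) {u v : α → E} {w : α → ℝ} {K C : ℝ}
    (hw : Integrable w μ) (hw0 : ∀ z, 0 < w z)
    (hu : ∀ z, ‖u z‖ ^ 2 ≤ K) (hv : ∀ z, ‖v z‖ ^ 2 ≤ C * w z ^ 2)
    (hi : ∀ i, Integrable (fun z => inner ℂ (u z) (b i) * inner ℂ (b i) (v z)) μ) :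
    HasSum (fun i => ∫ z, inner ℂ (u z) (b i) * inner ℂ (b i) (v z) ∂μ)
      (∫ z, inner ℂ (u z) (v z) ∂μ) := by
  have hbound : ∀ (s : Finset ι) z,
      ∑ i ∈ s, ‖inner ℂ (u z) (b i) * inner ℂ (b i) (v z)‖ ≤ (K + C) / 2 * w z := by
    intro s z
    have h1 : ∑ i ∈ s, ‖inner ℂ (b i) (u z)‖ ^ 2 ≤ K :=
      (b.orthonormal.sum_inner_products_le (u z)).trans (hu z)
    have h2 : ∑ i ∈ s, ‖inner ℂ (b i) (v z)‖ ^ 2 ≤ C * w z ^ 2 :=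
      (b.orthonormal.sum_inner_products_le (v z)).trans (hv z)
    have hwz := hw0 z
    calc ∑ i ∈ s, ‖inner ℂ (u z) (b i) * inner ℂ (b i) (v z)‖
        ≤ ∑ i ∈ s, (w z / 2 * ‖inner ℂ (b i) (u z)‖ ^ 2
            + (w z)⁻¹ / 2 * ‖inner ℂ (b i) (v z)‖ ^ 2) := by
          refine Finset.sum_le_sum fun i _ => ?_
          rw [norm_mul, norm_inner_symm (u z)]
          set p := ‖inner ℂ (b i) (u z)‖
          set q := ‖inner ℂ (b i) (v z)‖
          have : w z / 2 * p ^ 2 + (w z)⁻¹ / 2 * q ^ 2 - p * q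
              = (w z)⁻¹ / 2 * (w z * p - q) ^ 2 := by
            field_simp
            ring
          have : 0 ≤ (w z)⁻¹ / 2 * (w z * p - q) ^ 2 := by positivity
          linarith
      _ ≤ w z / 2 * K + (w z)⁻¹ / 2 * (C * w z ^ 2) := by
          rw [Finset.sum_add_distrib, ← Finset.mul_sum, ← Finset.mul_sum]
          gcongr
      _ = (K + C) / 2 * w z := by
          field_simp
  have hsum : Summable fun i => ∫ z, ‖inner ℂ (u z) (b i) * inner ℂ (b i) (v z)‖ ∂μ := by
    refine summable_of_sum_le (c := ∫ z, (K + C) / 2 * w z ∂μ)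
      (fun i => integral_nonneg fun z => norm_nonneg _) fun s => ?_
    rw [← integral_finsetSum _ fun i _ => (hi i).norm]
    exact integral_mono (integrable_finsetSum _ fun i _ => (hi i).norm) (hw.const_mul _)
      (hbound s)
  have := hasSum_integral_of_summable_integral_norm hi hsum
  simpa only [(b.hasSum_inner_mul_inner _ _).tsum_eq] using this

/-- The trace of `M_f` composed with convolution by the Gaussian `e^{-(a/2)‖x‖²}` is `∫ f`. -/
theorem hasSum_integral_mul_gauss {f : V → ℂ} (hf : Continuous f) (hs : HasCompactSupport f)
    {a : ℝ} (ha : 0 < a) {ι : Type*} (b : HilbertBasis ι ℂ (Lp ℂ 2 (volume : Measure V))) :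
    HasSum (fun i => ∫ x, (starRingEnd ℂ) (b i x) *
      (f x * ∫ y, gauss (a / 2) (x - y) * b i y)) (∫ x, f x) := by
  have : Countable ι := by
    have : Fact ((2 : ENNReal) ≠ ⊤) := ⟨by simp⟩
    exact b.orthonormal.countable_index
  have h2a : 0 < 2 * a := by positivity
  have hu := fun z : V => memLp_gauss_sub ha z
  have hv := fun z : V => memLp_mul_gauss_sub hf hs a z
  obtain ⟨C, hC⟩ := exists_norm_toLp_mul_gauss_sub_sq_le hf hs ha
  have hG := integral_gauss_ne_zero (V := V) h2a
  have hb : ∀ i, MemLp (b i) 2 volume := fun i => Lp.memLp (b i)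
  have hf2 : MemLp f 2 volume := hf.memLp_of_hasCompactSupport hs
  have hh : ∀ i, Integrable fun x => (starRingEnd ℂ) (b i x) * f x := fun i =>
    (hb i).star.integrable_mul hf2
  have hswap := fun i => integral_mul_integral_gauss_mul ha (hh i)
    (aestronglyMeasurable_integral_gauss_mul a (hb i).aestronglyMeasurable)
    (norm_integral_gauss_mul_le ha (hb i))
  have hterm : ∀ i z, inner ℂ ((hu z).toLp _) (b i) * inner ℂ (b i) ((hv z).toLp _) =
      (∫ y, gauss a (z - y) * b i y) *
        ∫ x, (starRingEnd ℂ) (b i x) * f x * gauss a (x - z) := by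
    intro i z
    rw [inner_toLp_left, inner_toLp_right]
    simp_rw [conj_gauss, gauss_sub_comm a z, mul_assoc]
  have key := b.hasSum_integral_inner_mul_inner (μ := (volume : Measure V))
    (u := fun z => (hu z).toLp _) (v := fun z => (hv z).toLp _)
    (w := fun z => ‖gauss (a / 2) z‖) (K := ∫ x : V, ‖gauss (2 * a) x‖) (C := C)
    (integrable_gauss (by positivity)).norm
    (fun z => by rw [norm_gauss]; positivity)
    (fun z => by
      rw [norm_toLp_sq]
      simp_rw [norm_gauss_sq]
      rw [integral_sub_right_eq_self (fun x : V => ‖gauss (2 * a) x‖)])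
    (fun z => by rw [norm_toLp_sq]; exact hC z)
    (fun i => by simp_rw [hterm]; exact (hswap i).1)
  have hlim : ∫ z, inner ℂ ((hu z).toLp _) ((hv z).toLp _) =
      (∫ z : V, gauss (2 * a) z) * ∫ x, f x := by
    have h1 := (integral_mul_integral_gauss_mul h2a
      (hf.integrable_of_hasCompactSupport hs) (B := fun _ => 1)
      aestronglyMeasurable_const (C := 1) (by simp)).2
    simp only [mul_one, one_mul] at h1
    simp_rw [inner_toLp_toLp, conj_gauss]
    rw [mul_comm, ← integral_mul_const]
    refine Eq.trans ?_ (h1.symm.trans ?_)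
    · simp_rw [mul_left_comm, gauss_mul_self]
    · simp_rw [integral_sub_left_eq_self (gauss (2 * a))]
  rw [hlim] at key
  have key' := key.mul_left (∫ z : V, gauss (2 * a) z)⁻¹
  rw [inv_mul_cancel_left₀ hG] at key'
  refine key'.congr_fun ?_
  intro i
  simp_rw [hterm]
  rw [← (hswap i).2]
  simp_rw [integral_gauss_mul_integral ha (hb i)]
  rw [← integral_const_mul]
  congr 1 with x
  rw [mul_left_comm (_ * f x), inv_mul_cancel_left₀ hG, mul_assoc]

end Trace

/-- Let `d ≥ 1`, `f ∈ C_c^∞(ℝ^{2d})` and `t > 0`. Then for every Hilbert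
(orthonormal) basis `(e_i)` of `L²(ℝ^{2d})` the family `(⟨e_i, M_f 𝓣_t e_i⟩)` is summable
with sum `(2πt)^{−d} ∫ f(x) dx`; in particular
`t^d (2π)^d ∑_i ⟨e_i, M_f 𝓣_t e_i⟩ = ∫ f(x) dx`. -/
theorem trace_Mf_heat_semigroup
    (d : ℕ) (hd : 1 ≤ d)
    (f : EuclideanSpace ℝ (Fin (2 * d)) → ℂ)
    (hf_smooth : ContDiff ℝ (⊤ : ℕ∞) f) (hf_supp : HasCompactSupport f)
    (t : ℝ) (ht : 0 < t)
    (ι : Type) (b : HilbertBasis ι ℂ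
      (Lp ℂ 2 (volume : Measure (EuclideanSpace ℝ (Fin (2 * d)))))) :
    HasSum
      (fun i : ι => ∫ x : EuclideanSpace ℝ (Fin (2 * d)),
        (starRingEnd ℂ) ((b i : Lp ℂ 2 (volume : Measure (EuclideanSpace ℝ (Fin (2 * d))))) x)
          * (f x * heatSemigroup d t (⇑(b i)) x))
      ((((2 * Real.pi * t) ^ d : ℝ) : ℂ)⁻¹ * ∫ x : EuclideanSpace ℝ (Fin (2 * d)), f x) ∧
    (((t ^ d * (2 * Real.pi) ^ d : ℝ) : ℂ) *
        ∑' i : ι, ∫ x : EuclideanSpace ℝ (Fin (2 * d)),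
          (starRingEnd ℂ) ((b i : Lp ℂ 2 (volume : Measure (EuclideanSpace ℝ (Fin (2 * d))))) x)
            * (f x * heatSemigroup d t (⇑(b i)) x)) =
      ∫ x : EuclideanSpace ℝ (Fin (2 * d)), f x := by
  have hsum : HasSum
      (fun i : ι => ∫ x : EuclideanSpace ℝ (Fin (2 * d)),
        (starRingEnd ℂ) ((b i : Lp ℂ 2 (volume : Measure (EuclideanSpace ℝ (Fin (2 * d))))) x)
          * (f x * heatSemigroup d t (⇑(b i)) x))
      ((((2 * Real.pi * t) ^ d : ℝ) : ℂ)⁻¹ * ∫ x : EuclideanSpace ℝ (Fin (2 * d)), f x) := by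
    refine ((hasSum_integral_mul_gauss hf_smooth.continuous hf_supp (inv_pos.2 ht) b).mul_left
      (((2 * Real.pi * t) ^ d : ℝ) : ℂ)⁻¹).congr_fun ?_
    intro i
    have hg : ∀ x : EuclideanSpace ℝ (Fin (2 * d)),
        ((Real.exp (-‖x‖ ^ 2 / (2 * t)) : ℝ) : ℂ) = gauss (t⁻¹ / 2) x := by
      intro x
      rw [gauss]
      congr 2
      field_simp
    rw [← integral_const_mul]
    congr 1 with x
    simp only [heatSemigroup, hg]
    ring
  refine ⟨hsum, ?_⟩
  have hc : (((2 * Real.pi * t) ^ d : ℝ) : ℂ) ≠ 0 := by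
    exact_mod_cast (by positivity : (2 * Real.pi * t) ^ d ≠ 0)
  rw [hsum.tsum_eq, ← mul_pow, mul_comm t, mul_inv_cancel_left₀ hc]

end
end
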